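/- arXiv:2604.18014 — 3 statements merged into one kernel-verified Lean document; each statement's English description precedes it below -/
import Mathlib

section
/- For all positive integers m, n, every stream x : Fin m → Fin n, and every symbol a ∈ Fin n, Σ_{q : x_q ≠ a} (λ_m(r_q) − λ_m(r_q − 1)) = Σ_{i ≠ a, m_i > 0} m_i · log₂(m/m_i). -/
open Finset

/-- `lam m r = r * log₂(m/r)` for `r ≥ 1`, and `lam m 0 = 0`. -/
noncomputable def lam (m r : ℕ) : ℝ :=
  if r = 0 then 0 else (r : ℝ) * Real.logb 2 ((m : ℝ) / (r : ℝ))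

/-- Frequency of symbol `i` in the stream `x`. -/
def freq {m n : ℕ} (x : Fin m → Fin n) (i : Fin n) : ℕ :=
  (Finset.univ.filter (fun j => x j = i)).card

/-- `suffCount x q` = number of occurrences of `x q` from position `q` to the end. -/
def suffCount {m n : ℕ} (x : Fin m → Fin n) (q : Fin m) : ℕ :=
  (Finset.univ.filter (fun j => q ≤ j ∧ x j = x q)).card


/-- Summing the increments of `f` along the ranks, counted from the top, of the elements of a
finite set telescopes. -/
lemma sum_sub_card_filter_le {α G : Type*} [LinearOrder α] [AddCommGroup G] (f : ℕ → G)
    (s : Finset α) :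
    ∑ q ∈ s, (f (s.filter (q ≤ ·)).card - f ((s.filter (q ≤ ·)).card - 1)) =
      f s.card - f 0 := by
  induction s using Finset.induction_on_min with
  | empty => simp
  | insert b s hb ih =>
    have hbs : b ∉ s := fun h => lt_irrefl b (hb b h)
    have hself : (insert b s).filter (b ≤ ·) = insert b s :=
      Finset.filter_true_of_mem fun c hc => by
        rcases Finset.mem_insert.mp hc with rfl | hc
        · exact le_rfl
        · exact (hb c hc).le
    have hrest : ∀ q ∈ s, (insert b s).filter (q ≤ ·) = s.filter (q ≤ ·) := fun q hq => by
      rw [Finset.filter_insert, if_neg (hb q hq).not_ge]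
    rw [Finset.sum_insert hbs, hself, Finset.sum_congr rfl fun q hq => by rw [hrest q hq], ih,
      Finset.card_insert_of_notMem hbs, Nat.add_sub_cancel]
    abel

theorem stmt_13 (m n : ℕ) (hm : 0 < m) (hn : 0 < n) (x : Fin m → Fin n) (a : Fin n) :
    ∑ q ∈ Finset.univ.filter (fun q => x q ≠ a),
        (lam m (suffCount x q) - lam m (suffCount x q - 1)) =
      ∑ i ∈ Finset.univ.filter (fun i => i ≠ a ∧ 0 < freq x i),
        (freq x i : ℝ) * Real.logb 2 ((m : ℝ) / (freq x i : ℝ)) := by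
  have hfiber : ∀ i, ∑ q ∈ Finset.univ.filter (fun q => x q = i),
      (lam m (suffCount x q) - lam m (suffCount x q - 1)) = lam m (freq x i) := fun i => by
    have h := sum_sub_card_filter_le (lam m) (Finset.univ.filter (fun q => x q = i))
    rw [show lam m 0 = 0 from if_pos rfl, sub_zero] at h
    rw [freq, ← h]
    refine Finset.sum_congr rfl fun q hq => ?_
    have hc : suffCount x q =
        ((Finset.univ.filter (fun j => x j = i)).filter (q ≤ ·)).card := by
      rw [suffCount, (Finset.mem_filter.mp hq).2, Finset.filter_filter]
      simp only [and_comm]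
    rw [hc]
  rw [← Finset.sum_fiberwise_of_maps_to (s := Finset.univ.filter (fun q => x q ≠ a))
    (t := Finset.univ.filter (fun i => i ≠ a)) (g := x) (by simp)]
  rw [← Finset.filter_filter, Finset.sum_filter (fun i => 0 < freq x i)]
  refine Finset.sum_congr rfl fun i hi => ?_
  have hia : i ≠ a := (Finset.mem_filter.mp hi).2
  have hset : (Finset.univ.filter (fun q => x q ≠ a)).filter (fun q => x q = i) =
      Finset.univ.filter (fun q => x q = i) := by
    ext q
    simp only [Finset.mem_filter, Finset.mem_univ, true_and, and_iff_right_iff_imp]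
    rintro rfl
    exact hia
  rw [hset, hfiber, lam]
  simp only [Nat.pos_iff_ne_zero, ite_not]
end

section
/- For every integer m ≥ 2 and every integer r with 1 ≤ r ≤ m/2, the increment satisfies λ_m(r) − λ_m(r − 1) ≥ 1 − log₂ e. -/
theorem lam_eq_mul_log_sub_log_div {m : ℕ} (hm : m ≠ 0) (r : ℕ) :
    lam m r = r * (Real.log m - Real.log r) / Real.log 2 := by
  rcases eq_or_ne r 0 with rfl | hr
  · simp [lam]
  · rw [lam, if_neg hr, Real.logb, Real.log_div (by exact_mod_cast hm) (by exact_mod_cast hr),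
      mul_div_assoc]

theorem natCast_mul_log_succ_sub_log_le_one (s : ℕ) :
    (s : ℝ) * (Real.log (s + 1) - Real.log s) ≤ 1 := by
  rcases Nat.eq_zero_or_pos s with rfl | hs
  · simp
  · have hs' : (0 : ℝ) < s := by exact_mod_cast hs
    rw [← Real.log_div (by positivity) hs'.ne']
    calc (s : ℝ) * Real.log ((s + 1) / s) ≤ s * ((s + 1) / s - 1) := by
          gcongr
          exact Real.log_le_sub_one_of_pos (by positivity)
      _ = 1 := by field_simp; ring

theorem stmt_14 (m r : ℕ) (hm : 2 ≤ m) (hr1 : 1 ≤ r) (hr : (r : ℝ) ≤ (m : ℝ) / 2) :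
    lam m r - lam m (r - 1) ≥ 1 - Real.logb 2 (Real.exp 1) := by
  obtain ⟨s, rfl⟩ := Nat.exists_eq_add_of_le' hr1
  have hlog2 : 0 < Real.log 2 := Real.log_pos one_lt_two
  have hlog : Real.log 2 + Real.log (s + 1) ≤ Real.log m := by
    rw [← Real.log_mul two_ne_zero (by positivity)]
    push_cast at hr
    exact Real.log_le_log (by positivity) (by linarith)
  have hinc := natCast_mul_log_succ_sub_log_le_one s
  rw [lam_eq_mul_log_sub_log_div (by omega), lam_eq_mul_log_sub_log_div (by omega),
    Nat.add_sub_cancel, Real.logb, Real.log_exp, ge_iff_le, ← sub_div, one_sub_div hlog2.ne']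
  refine div_le_div_of_nonneg_right ?_ hlog2.le
  push_cast
  linarith
end

section
/- Let x : Fin m → Fin n be a stream (m, n positive integers) in which every symbol frequency satisfies m_i ≤ m/2. Then (1/m) · Σ_{q=1}^{m} (λ_m(r_q) − λ_m(r_q − 1)) ≥ 1. -/
open Finset

theorem sum_card_filter_le_telescope {α : Type*} [LinearOrder α] (f : ℕ → ℝ) (s : Finset α) :
    ∑ q ∈ s, (f #{j ∈ s | q ≤ j} - f (#{j ∈ s | q ≤ j} - 1)) = f #s - f 0 := by
  induction s using Finset.induction_on_min with
  | empty => simp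
  | insert a s ha ih =>
    have has : a ∉ s := fun h => lt_irrefl a (ha a h)
    have h_min : {j ∈ insert a s | a ≤ j} = insert a s := by
      refine filter_true_of_mem fun j hj => ?_
      rcases mem_insert.1 hj with rfl | hj
      · exact le_rfl
      · exact (ha j hj).le
    have h_rest : ∀ q ∈ s, {j ∈ insert a s | q ≤ j} = {j ∈ s | q ≤ j} := fun q hq => by
      rw [filter_insert, if_neg (not_le.2 (ha q hq))]
    rw [sum_insert has, h_min, sum_congr rfl fun q hq => by rw [h_rest q hq], ih,
      card_insert_of_notMem has, Nat.add_sub_cancel]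
    ring

theorem sum_lam_suffCount {m n : ℕ} (x : Fin m → Fin n) :
    ∑ q : Fin m, (lam m (suffCount x q) - lam m (suffCount x q - 1)) =
      ∑ i, lam m (freq x i) := by
  rw [← sum_fiberwise univ x]
  refine sum_congr rfl fun i _ => ?_
  have h_tele := sum_card_filter_le_telescope (lam m) ({j | x j = i} : Finset (Fin m))
  rw [show lam m 0 = 0 from if_pos rfl, sub_zero] at h_tele
  refine Eq.trans (sum_congr rfl fun q hq => ?_) h_tele
  have h_count : suffCount x q = #{j ∈ ({j | x j = i} : Finset (Fin m)) | q ≤ j} := by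
    rw [suffCount, (mem_filter.1 hq).2, filter_filter]
    simp only [and_comm]
  rw [h_count]

theorem le_lam {m r : ℕ} (h : (r : ℝ) ≤ (m : ℝ) / 2) : (r : ℝ) ≤ lam m r := by
  rcases Nat.eq_zero_or_pos r with rfl | hr
  · simp [lam]
  have hr' : (0 : ℝ) < r := by exact_mod_cast hr
  have h_two : (2 : ℝ) ≤ m / r := by
    rw [le_div_iff₀ hr']
    linarith
  have h_log : (1 : ℝ) ≤ Real.logb 2 (m / r) := by
    rw [Real.le_logb_iff_rpow_le one_lt_two (by linarith), Real.rpow_one]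
    exact h_two
  rw [lam, if_neg hr.ne']
  exact le_mul_of_one_le_right hr'.le h_log

theorem sum_freq {m n : ℕ} (x : Fin m → Fin n) : ∑ i, freq x i = m := by
  simpa [freq] using (card_eq_sum_card_fiberwise (f := x) (s := univ) (t := univ)
    (fun _ _ => by simp)).symm

theorem stmt_17 (m n : ℕ) (hm : 0 < m) (hn : 0 < n) (x : Fin m → Fin n)
    (hmaj : ∀ i, (freq x i : ℝ) ≤ (m : ℝ) / 2) :
    (1 / (m : ℝ)) * ∑ q : Fin m, (lam m (suffCount x q) - lam m (suffCount x q - 1)) ≥ 1 := by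
  have hm' : (0 : ℝ) < m := by exact_mod_cast hm
  have h_sum : (m : ℝ) ≤ ∑ i, lam m (freq x i) :=
    calc (m : ℝ) = ∑ i, (freq x i : ℝ) := by exact_mod_cast (sum_freq x).symm
      _ ≤ _ := sum_le_sum fun i _ => le_lam (hmaj i)
  rw [sum_lam_suffCount, ge_iff_le, one_div_mul_eq_div, le_div_iff₀ hm', one_mul]
  exact h_sum
end
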